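/- For each positive integer l, there exists an l-strong digraph that is not 2-linked. -/

import Mathlib

/-- A simple digraph: an irreflexive adjacency relation (no loops, no parallel arcs). -/
structure Digr (V : Type) where
  Adj : V → V → Prop
  irrefl : ∀ v, ¬ Adj v v

namespace Digr

variable {V : Type}

/-- `p` is a directed path (as a list of distinct vertices) from `x` to `y`. -/
def IsPathFrom (G : Digr V) (p : List V) (x y : V) : Prop :=
  p.head? = some x ∧ p.getLast? = some y ∧ p.Chain' G.Adj ∧ p.Nodup

/-- A path from `x` to `y` all of whose vertices lie in `A`. -/
def IsPathOn (G : Digr V) (A : Set V) (p : List V) (x y : V) : Prop :=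
  G.IsPathFrom p x y ∧ ∀ v ∈ p, v ∈ A

/-- The digraph restricted to `A` is strongly connected. -/
def StronglyConnectedOn (G : Digr V) (A : Set V) : Prop :=
  ∀ x ∈ A, ∀ y ∈ A, x ≠ y → ∃ p, G.IsPathOn A p x y

/-- A digraph is strong if every ordered pair of distinct vertices is joined by a path. -/
def IsStrong (G : Digr V) : Prop :=
  ∀ x y : V, x ≠ y → ∃ p, G.IsPathFrom p x y

/-- `G` is `k`-strong: at least `k+1` vertices, and deleting any at most `k-1`
vertices leaves a strongly connected digraph. -/
def KStrong [Fintype V] (G : Digr V) (k : ℕ) : Prop :=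
  k + 1 ≤ Fintype.card V ∧
  ∀ S : Finset V, S.card ≤ k - 1 → G.StronglyConnectedOn ((↑S : Set V)ᶜ)

/-- `G` is `k`-linked. -/
def KLinked [Fintype V] (G : Digr V) (k : ℕ) : Prop :=
  2 * k ≤ Fintype.card V ∧
  ∀ x y : Fin k → V, Function.Injective (Sum.elim x y) →
    ∃ P : Fin k → List V,
      (∀ i, G.IsPathFrom (P i) (x i) (y i)) ∧
      (∀ i j, i ≠ j → ∀ v, v ∈ P i → v ∉ P j)

/-- Semicomplete: at least one arc between any two distinct vertices. -/
def Semicomplete (G : Digr V) : Prop :=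
  ∀ x y : V, x ≠ y → G.Adj x y ∨ G.Adj y x

/-- Out-degree of a vertex. -/
noncomputable def outDeg [Fintype V] (G : Digr V) (v : V) : ℕ :=
  Set.ncard {w | G.Adj v w}

/-- In-degree of a vertex. -/
noncomputable def inDeg [Fintype V] (G : Digr V) (v : V) : ℕ :=
  Set.ncard {w | G.Adj w v}

/-- `G` together with the surjection `φ : V → ι` realizes a composition `H[S₁,…,S_h]`:
between distinct parts, the arcs of `G` are exactly those prescribed by `H`. -/
def IsCompositionOver {ι : Type} (G : Digr V) (H : Digr ι) (φ : V → ι) : Prop :=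
  Function.Surjective φ ∧ ∀ u v : V, φ u ≠ φ v → (G.Adj u v ↔ H.Adj (φ u) (φ v))

end Digr

/-- Sum of `f` over the consecutive pairs of a list. -/
def stepSum {α : Type} (f : α → α → ZMod 2) : List α → ZMod 2
  | [] => 0
  | [_] => 0
  | u :: v :: l => f u v + stepSum f (v :: l)

theorem stepSum_congr {α : Type} {f g : α → α → ZMod 2} {l : List α}
    (h : l.IsChain fun u v => f u v = g u v) : stepSum f l = stepSum g l := by
  induction l with
  | nil => rfl
  | cons u l ih =>
    cases l with
    | nil => rfl
    | cons v l =>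
      rw [List.isChain_cons_cons] at h
      simp only [stepSum]
      rw [h.1, ih h.2]

theorem stepSum_add {α : Type} (f g : α → α → ZMod 2) (l : List α) :
    stepSum (fun u v => f u v + g u v) l = stepSum f l + stepSum g l := by
  induction l with
  | nil => rfl
  | cons u l ih =>
    cases l with
    | nil => rfl
    | cons v l =>
      simp only [stepSum] at ih ⊢
      rw [ih]; ring

theorem stepSum_telescope {α : Type} (g : α → ZMod 2) (l : List α) (hl : l ≠ []) :
    stepSum (fun u v => g u + g v) l = g (l.head hl) + g (l.getLast hl) := by
  induction l with
  | nil => exact absurd rfl hl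
  | cons u l ih =>
    cases l with
    | nil => simpa [stepSum] using (CharTwo.add_self_eq_zero (g u)).symm
    | cons v l =>
      have := ih (by simp)
      simp only [stepSum, List.head_cons] at this ⊢
      rw [this, List.getLast_cons (List.cons_ne_nil v l)]
      linear_combination CharTwo.add_self_eq_zero (g v)

/-- Adjacency in a strip of columns; `R i` relates the cells of columns `i` and `i + 1`. -/
def StripAdj (R : ℕ → ℕ → ℕ → Prop) (u v : ℕ × ℕ) : Prop :=
  (u.1 = v.1 ∧ (v.2 = u.2 + 1 ∨ u.2 = v.2 + 1)) ∨
    (v.1 = u.1 + 1 ∧ R u.1 u.2 v.2) ∨ (u.1 = v.1 + 1 ∧ R v.1 v.2 u.2)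

/-- The relations between consecutive columns do not cross. -/
def NonCrossing (R : ℕ → ℕ → ℕ → Prop) : Prop :=
  ∀ i q q' p p', R i q q' → R i p p' → (q < p → q' ≤ p') ∧ (q' < p' → q ≤ p)

/-- The step `uv` goes between the column left of `z` and a cell below `z` in its column. -/
def StepBelow (z u v : ℕ × ℕ) : Prop :=
  (u.1 + 1 = z.1 ∧ v.1 = z.1 ∧ v.2 < z.2) ∨ (v.1 + 1 = z.1 ∧ u.1 = z.1 ∧ u.2 < z.2)

open Classical in
/-- Parity of the number of steps of `l` that enter or leave, from the left, the part of the
column of `z` below `z`. -/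
noncomputable def parityBelow (l : List (ℕ × ℕ)) (z : ℕ × ℕ) : ZMod 2 :=
  stepSum (fun u v => if StepBelow z u v then 1 else 0) l

theorem StripAdj.symm {R : ℕ → ℕ → ℕ → Prop} {u v : ℕ × ℕ} (h : StripAdj R u v) :
    StripAdj R v u := by
  rcases h with ⟨h, h'⟩ | h | h
  · exact Or.inl ⟨h.symm, h'.symm⟩
  · exact Or.inr (Or.inr h)
  · exact Or.inr (Or.inl h)

theorem isChain_and_of_forall {α : Type} {R : α → α → Prop} {p : α → Prop} {l : List α}
    (h : l.IsChain R) (hp : ∀ v ∈ l, p v) : l.IsChain fun u v => R u v ∧ p u ∧ p v := by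
  induction l with
  | nil => simp
  | cons u l ih =>
    cases l with
    | nil => simp
    | cons v l =>
      rw [List.isChain_cons_cons] at h ⊢
      exact ⟨⟨h.1, hp u (by simp), hp v (by simp)⟩, ih h.2 fun w hw => hp w (by simp [hw])⟩

theorem ite_add_ite_eq {A B C D : Prop} [Decidable A] [Decidable B] [Decidable C] [Decidable D]
    (h : ((A ∧ ¬B) ∨ (B ∧ ¬A)) ↔ ((C ∧ ¬D) ∨ (D ∧ ¬C))) :
    (if A then (1 : ZMod 2) else 0) + (if B then 1 else 0) =
      (if C then 1 else 0) + (if D then 1 else 0) := by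
  by_cases hA : A <;> by_cases hB : B <;> by_cases hC : C <;> by_cases hD : D <;>
    simp only [hA, hB, hC, hD, if_true, if_false] <;> first | rfl | decide | tauto

theorem ite_eq_ite_add {A C D : Prop} [Decidable A] [Decidable C] [Decidable D]
    (h : A ↔ ((C ∧ ¬D) ∨ (D ∧ ¬C))) :
    (if A then (1 : ZMod 2) else 0) = (if C then 1 else 0) + (if D then 1 else 0) := by
  simpa using ite_add_ite_eq (A := A) (B := False) (by simpa using h)

open Classical in
theorem parityBelow_vertical {R : ℕ → ℕ → ℕ → Prop} {l : List (ℕ × ℕ)} {i q : ℕ}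
    (h : l.IsChain (StripAdj R)) (hz : (i, q) ∉ l) :
    parityBelow l (i, q) = parityBelow l (i, q + 1) := by
  refine stepSum_congr ((isChain_and_of_forall (p := fun v => v ≠ (i, q)) h
    fun v hv hvz => hz (hvz ▸ hv)).imp ?_)
  rintro ⟨a, b⟩ ⟨c, d⟩ ⟨-, h1, h2⟩
  have : StepBelow (i, q) (a, b) (c, d) ↔ StepBelow (i, q + 1) (a, b) (c, d) := by
    simp only [ne_eq, Prod.mk.injEq, StepBelow] at *
    omega
  exact if_congr this rfl rfl

open Classical in
theorem parityBelow_horizontal {R : ℕ → ℕ → ℕ → Prop} (hR : NonCrossing R)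
    {l : List (ℕ × ℕ)} {i q q' : ℕ} (h : l.IsChain (StripAdj R)) (hl : l ≠ [])
    (hq : R i q q') (hz : (i, q) ∉ l) (hz' : (i + 1, q') ∉ l) :
    parityBelow l (i, q) + parityBelow l (i + 1, q') =
      (if (l.head hl).1 = i ∧ (l.head hl).2 < q then 1 else 0) +
        (if (l.getLast hl).1 = i ∧ (l.getLast hl).2 < q then 1 else 0) := by
  rw [parityBelow, parityBelow, ← stepSum_add,
    ← stepSum_telescope (fun w : ℕ × ℕ => if w.1 = i ∧ w.2 < q then (1 : ZMod 2) else 0) l hl]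
  refine stepSum_congr ((isChain_and_of_forall (p := fun v => v ≠ (i, q) ∧ v ≠ (i + 1, q')) h
    fun v hv => ⟨fun e => hz (e ▸ hv), fun e => hz' (e ▸ hv)⟩).imp ?_)
  rintro ⟨a, b⟩ ⟨c, d⟩ ⟨h0, ⟨h1, h3⟩, h2, h4⟩
  have e1 := hR i q q' b d hq
  have e2 := hR i q q' d b hq
  refine ite_add_ite_eq ?_
  simp only [ne_eq, Prod.mk.injEq, StepBelow, StripAdj] at *
  rcases h0 with h0 | ⟨h0, h0'⟩ | ⟨h0, h0'⟩
  · omega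
  · by_cases ha : a = i
    · subst ha
      have e1 := e1 h0'
      omega
    · omega
  · by_cases ha : c = i
    · subst ha
      have e2 := e2 h0'
      omega
    · omega

theorem stepSum_eq_zero {α : Type} {f : α → α → ZMod 2} {l : List α}
    (h : l.IsChain fun u v => f u v = 0) : stepSum f l = 0 := by
  induction l with
  | nil => rfl
  | cons u l ih =>
    cases l with
    | nil => rfl
    | cons v l =>
      rw [List.isChain_cons_cons] at h
      simp only [stepSum]
      rw [h.1, ih h.2, add_zero]

theorem parityBelow_eq_zero {l : List (ℕ × ℕ)} {z : ℕ × ℕ} (h : ∀ u ∈ l, u.1 ≠ z.1) :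
    parityBelow l z = 0 := by
  refine stepSum_eq_zero ((isChain_and_of_forall (R := fun _ _ => True)
    (List.pairwise_of_forall fun _ _ => trivial).isChain h).imp ?_)
  rintro u v ⟨-, hu, hv⟩
  exact if_neg fun e => e.elim (fun e => hv e.2.1) fun e => hu e.2.1

theorem parityBelow_of_bottom {l : List (ℕ × ℕ)} {z : ℕ × ℕ} (h : z.1 = 0 ∨ z.2 = 0) :
    parityBelow l z = 0 := by
  refine stepSum_eq_zero (List.pairwise_of_forall fun u v => if_neg ?_).isChain
  rcases h with h | h <;> simp only [StepBelow] <;> omega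

theorem mem_of_isChain_and {α : Type} {R : α → α → Prop} {p : α → Prop} {l : List α}
    (h : l.IsChain fun u v => R u v ∧ p u) (hl : l ≠ []) (hp : p (l.getLast hl)) :
    ∀ u ∈ l, p u := by
  induction l with
  | nil => exact absurd rfl hl
  | cons u l ih =>
    cases l with
    | nil => simpa using hp
    | cons v l =>
      rw [List.isChain_cons_cons] at h
      rw [List.getLast_cons (List.cons_ne_nil v l)] at hp
      intro w hw
      rcases List.mem_cons.1 hw with rfl | hw
      · exact h.1.2
      · exact ih h.2 _ hp w hw

theorem getLast_of_isChain {α : Type} {p : α → Prop} {l : List α}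
    (h : l.IsChain fun u v => p u → p v) (hl : l ≠ []) (hp : p (l.head hl)) :
    p (l.getLast hl) := by
  induction l with
  | nil => exact absurd rfl hl
  | cons u l ih =>
    cases l with
    | nil => simpa using hp
    | cons v l =>
      rw [List.isChain_cons_cons] at h
      rw [List.getLast_cons (List.cons_ne_nil v l)]
      exact ih h.2 _ (h.1 hp)

/-- A chain of `R`- and `J`-steps either has no `J`-step or splits at its first `J`-step. -/
theorem isChain_or_split {α : Type} {R J : α → α → Prop} {l : List α}
    (h : l.IsChain fun u v => R u v ∨ J u v) :
    l.IsChain R ∨ ∃ (l₁ l₂ : List α) (h₁ : l₁ ≠ []) (h₂ : l₂ ≠ []), l = l₁ ++ l₂ ∧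
      l₁.IsChain R ∧ J (l₁.getLast h₁) (l₂.head h₂) := by
  induction l with
  | nil => simp
  | cons u l ih =>
    cases l with
    | nil => simp
    | cons v l =>
      rw [List.isChain_cons_cons] at h
      by_cases huv : R u v
      · rcases ih h.2 with h' | ⟨l₁, l₂, h₁, h₂, e, hc, hJ⟩
        · exact Or.inl (List.isChain_cons_cons.2 ⟨huv, h'⟩)
        · refine Or.inr ⟨u :: l₁, l₂, List.cons_ne_nil _ _, h₂, by rw [e]; rfl, ?_, ?_⟩
          · cases l₁ with
            | nil => exact absurd rfl h₁
            | cons w l₁ =>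
              obtain ⟨rfl, -⟩ := List.cons.inj e
              exact List.isChain_cons_cons.2 ⟨huv, hc⟩
          · rwa [List.getLast_cons h₁]
      · exact Or.inr ⟨[u], v :: l, List.cons_ne_nil _ _, List.cons_ne_nil _ _, rfl, by simp,
          h.1.resolve_left huv⟩

/-- The depth of column `c`. -/
def depth (k c : ℕ) : ℕ := if c ≤ 2 * k then 2 * k - c else c - (2 * k + 1)

/-- The number of cells in column `c`. -/
def width (k c : ℕ) : ℕ := (k + 1) ^ (depth k c + 1)

/-- The relation between columns `i` and `i + 1`. -/
def stripRel (k i q q' : ℕ) : Prop :=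
  (i < 2 * k ∧ q' = q / (k + 1)) ∨ (i = 2 * k ∧ q = q') ∨ (2 * k < i ∧ q = q' / (k + 1))

theorem nonCrossing_stripRel (k : ℕ) : NonCrossing (stripRel k) := by
  intro i q q' p p' h h'
  have h1 : q ≤ p → q / (k + 1) ≤ p / (k + 1) := fun h => Nat.div_le_div_right h
  have h2 : p ≤ q → p / (k + 1) ≤ q / (k + 1) := fun h => Nat.div_le_div_right h
  have h3 : q' ≤ p' → q' / (k + 1) ≤ p' / (k + 1) := fun h => Nat.div_le_div_right h
  have h4 : p' ≤ q' → p' / (k + 1) ≤ q' / (k + 1) := fun h => Nat.div_le_div_right h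
  unfold stripRel at h h'
  generalize q / (k + 1) = a at *
  generalize p / (k + 1) = b at *
  generalize q' / (k + 1) = a' at *
  generalize p' / (k + 1) = b' at *
  omega

/-- The cells of the two trees glued along their roots. -/
def IsCell (k : ℕ) (u : ℕ × ℕ) : Prop := u.1 ≤ 4 * k + 1 ∧ u.2 < width k u.1

/-- The column of the leaves of a side. -/
def leafCol (k : ℕ) : Bool → ℕ
  | false => 0
  | true => 4 * k + 1

/-- The columns of depth less than `k` of a side. -/
def IsInner (k : ℕ) : Bool → ℕ → Prop
  | false, c => k < c ∧ c ≤ 2 * k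
  | true, c => 2 * k < c ∧ c ≤ 3 * k

/-- The top cell of an inner column. -/
def IsInnerTop (k : ℕ) (σ : Bool) (u : ℕ × ℕ) : Prop := IsInner k σ u.1 ∧ u.2 + 1 = width k u.1

/-- The cells with arcs to the hubs of their side. -/
def IsExit (k : ℕ) (σ : Bool) (u : ℕ × ℕ) : Prop := u.1 = leafCol k σ ∨ IsInnerTop k σ u

/-- The cells with arcs from the hubs of their side. -/
def IsEntry (k : ℕ) (σ : Bool) (u : ℕ × ℕ) : Prop := IsInner k σ u.1 ∧ u.2 = 0

open Classical in
/-- The side of the list `l` on which `z` lies. -/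
noncomputable def sideOf (l : List (ℕ × ℕ)) (hl : l ≠ []) (z : ℕ × ℕ) : ZMod 2 :=
  parityBelow l z + if (l.head hl).1 < z.1 then 1 else 0

/-- A list of cells that leads from the bottom boundary of the strip to its top or its right
boundary. -/
structure IsBarrier (k : ℕ) (l : List (ℕ × ℕ)) (hl : l ≠ []) : Prop where
  isCell : ∀ u ∈ l, IsCell k u
  isChain : l.IsChain (StripAdj (stripRel k))
  head : (l.head hl).2 = 0
  last : (l.getLast hl).2 + 1 = width k (l.getLast hl).1 ∨ (l.getLast hl).1 = 4 * k + 1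

namespace IsBarrier

variable {k : ℕ} {l : List (ℕ × ℕ)} {hl : l ≠ []}

theorem sideOf_eq_of_rel (h : IsBarrier k l hl) {i q q' : ℕ} (hz : IsCell k (i, q))
    (hz' : IsCell k (i + 1, q')) (hzl : (i, q) ∉ l) (hzl' : (i + 1, q') ∉ l)
    (hq : stripRel k i q q') : sideOf l hl (i, q) = sideOf l hl (i + 1, q') := by
  have key := parityBelow_horizontal (nonCrossing_stripRel k) h.isChain hl hq hzl hzl'
  have hhead : (l.head hl).1 = i → q ≠ 0 := by
    rintro e rfl
    apply hzl
    have : l.head hl = (i, 0) := Prod.ext e h.head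
    exact this ▸ List.head_mem hl
  have h1 := h.head
  have h2 : ¬ ((l.getLast hl).1 = i ∧ (l.getLast hl).2 < q) := by
    rintro ⟨e, hlt⟩
    have h3 := h.last
    rw [e] at h3
    have h4 := hz.2
    have h5 := hz'.1
    dsimp only at h4 h5
    omega
  rw [if_neg h2] at key
  have e3 : parityBelow l (i, q) = parityBelow l (i + 1, q') +
      if (l.head hl).1 = i ∧ (l.head hl).2 < q then 1 else 0 := by
    have := CharTwo.add_self_eq_zero (parityBelow l (i + 1, q'))
    linear_combination key - this
  rw [sideOf, sideOf, e3, add_assoc]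
  congr 1
  refine (ite_eq_ite_add ?_).symm
  dsimp only
  omega

theorem sideOf_eq (h : IsBarrier k l hl) {u v : ℕ × ℕ} (hu : IsCell k u) (hv : IsCell k v)
    (hul : u ∉ l) (hvl : v ∉ l) (huv : StripAdj (stripRel k) u v) :
    sideOf l hl u = sideOf l hl v := by
  obtain ⟨a, b⟩ := u
  obtain ⟨c, d⟩ := v
  simp only [StripAdj] at huv
  rcases huv with ⟨rfl, rfl | rfl⟩ | ⟨rfl, e⟩ | ⟨rfl, e⟩
  · rw [sideOf, sideOf, parityBelow_vertical h.isChain hul]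
  · rw [sideOf, sideOf, parityBelow_vertical h.isChain hvl]
  · exact h.sideOf_eq_of_rel hu hv hul hvl e
  · exact (h.sideOf_eq_of_rel hv hu hvl hul e).symm

open Classical in
theorem sideOf_top (h : IsBarrier k l hl) {z : ℕ × ℕ} (hz : z ∉ l) (ht : z.2 + 1 = width k z.1) :
    sideOf l hl z = if (l.getLast hl).1 < z.1 then 1 else 0 := by
  have key : parityBelow l z =
      (if (l.head hl).1 < z.1 then 1 else 0) + if (l.getLast hl).1 < z.1 then 1 else 0 := by
    rw [parityBelow, ← stepSum_telescope (fun w : ℕ × ℕ => if w.1 < z.1 then (1 : ZMod 2) else 0)]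
    refine stepSum_congr ((isChain_and_of_forall (p := fun v => v ≠ z ∧ IsCell k v) h.isChain
      fun v hv => ⟨fun e => hz (e ▸ hv), h.isCell v hv⟩).imp ?_)
    rintro ⟨a, b⟩ ⟨c, d⟩ ⟨hs, ⟨hu, hu'⟩, hv, hv'⟩
    obtain ⟨i, q⟩ := z
    refine ite_eq_ite_add ?_
    have h1 := hu'.2
    have h2 := hv'.2
    have h3 : a = i → width k a = width k i := congrArg _
    have h4 : c = i → width k c = width k i := congrArg _
    simp only [ne_eq, Prod.mk.injEq, StepBelow, StripAdj] at *
    generalize stripRel k a b d = X at *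
    generalize stripRel k c d b = Y at *
    omega
  rw [sideOf, key]
  have := CharTwo.add_self_eq_zero (if (l.head hl).1 < z.1 then (1 : ZMod 2) else 0)
  linear_combination this

end IsBarrier

/-- Hubs (a side and an index) and cells. -/
inductive Node
  | hub (σ : Bool) (a : ℕ)
  | cell (u : ℕ × ℕ)

namespace Node

/-- The nodes of the digraph. -/
def Valid (k : ℕ) : Node → Prop
  | hub _ a => a ≤ k
  | cell u => IsCell k u

/-- The arcs of the digraph. -/
def Arc (k : ℕ) : Node → Node → Prop
  | hub _ _, hub _ _ => False
  | hub σ _, cell u => IsEntry k σ u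
  | cell u, hub σ _ => IsExit k σ u
  | cell u, cell v => StripAdj (stripRel k) u v ∨ ∃ σ, IsInnerTop k σ u ∧ v.1 = leafCol k σ

/-- The reflection exchanging the two sides. -/
def mirror (k : ℕ) : Node → Node
  | hub σ a => hub (!σ) a
  | cell u => cell (4 * k + 1 - u.1, u.2)

end Node

open Node

theorem width_mirror {k c : ℕ} (h : c ≤ 4 * k + 1) : width k (4 * k + 1 - c) = width k c := by
  unfold width depth
  congr 2
  split_ifs <;> omega

theorem isInner_mirror {k c : ℕ} {σ : Bool} (h : IsInner k σ c) :
    IsInner k (!σ) (4 * k + 1 - c) := by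
  cases σ <;> simp only [IsInner, Bool.not_false, Bool.not_true] at * <;> omega

theorem leafCol_mirror {k c : ℕ} {σ : Bool} (h : c = leafCol k σ) :
    4 * k + 1 - c = leafCol k (!σ) := by
  cases σ <;> simp only [leafCol, Bool.not_false, Bool.not_true] at * <;> omega

theorem isInnerTop_mirror {k : ℕ} {u : ℕ × ℕ} {σ : Bool} (hu : IsCell k u)
    (h : IsInnerTop k σ u) : IsInnerTop k (!σ) (4 * k + 1 - u.1, u.2) :=
  ⟨isInner_mirror h.1, h.2.trans (width_mirror hu.1).symm⟩

theorem stripAdj_mirror {k : ℕ} {u v : ℕ × ℕ} (hu : IsCell k u) (hv : IsCell k v)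
    (h : StripAdj (stripRel k) u v) :
    StripAdj (stripRel k) (4 * k + 1 - u.1, u.2) (4 * k + 1 - v.1, v.2) := by
  have h1 := hu.1
  have h2 := hv.1
  have key : ∀ {i q q'}, i ≤ 4 * k → stripRel k i q q' → stripRel k (4 * k - i) q' q := by
    intro i q q' hi h
    unfold stripRel at *
    generalize q / (k + 1) = a at *
    generalize q' / (k + 1) = b at *
    rcases h with h | h | h
    · exact Or.inr (Or.inr ⟨by omega, h.2⟩)
    · exact Or.inr (Or.inl ⟨by omega, h.2.symm⟩)
    · exact Or.inl ⟨by omega, h.2⟩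
  rcases h with ⟨h, h'⟩ | ⟨h, h'⟩ | ⟨h, h'⟩
  · exact Or.inl ⟨congrArg (4 * k + 1 - ·) h, h'⟩
  · refine Or.inr (Or.inr ⟨by dsimp only; omega, ?_⟩)
    have e : 4 * k + 1 - v.1 = 4 * k - u.1 := by omega
    dsimp only
    rw [e]
    exact key (by omega) h'
  · refine Or.inr (Or.inl ⟨by dsimp only; omega, ?_⟩)
    have e : 4 * k + 1 - u.1 = 4 * k - v.1 := by omega
    dsimp only
    rw [e]
    exact key (by omega) h'

theorem Node.valid_mirror {k : ℕ} {u : Node} (hu : u.Valid k) : (u.mirror k).Valid k := by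
  cases u with
  | hub σ a => exact hu
  | cell u => exact ⟨Nat.sub_le _ _, (width_mirror hu.1).symm ▸ hu.2⟩

theorem Node.arc_mirror {k : ℕ} {u v : Node} (hu : u.Valid k) (hv : v.Valid k)
    (h : Arc k u v) : Arc k (u.mirror k) (v.mirror k) := by
  cases u with
  | hub σ a =>
    cases v with
    | hub τ b => exact h
    | cell v => exact ⟨isInner_mirror h.1, h.2⟩
  | cell u =>
    cases v with
    | hub τ b => exact h.imp leafCol_mirror (isInnerTop_mirror hu)
    | cell v =>
      rcases h with h | ⟨σ, h, h'⟩
      · exact Or.inl (stripAdj_mirror hu hv h)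
      · exact Or.inr ⟨!σ, isInnerTop_mirror hu h, leafCol_mirror h'⟩

/-- `L` leads from an entry of the left side to the first exit of the right side. -/
structure IsSegment (k : ℕ) (L : List (ℕ × ℕ)) (hL : L ≠ []) : Prop where
  isChain : L.IsChain fun u v => Arc k (cell u) (cell v) ∧ ¬ IsExit k true u
  last : IsExit k true (L.getLast hL)

theorem exists_isSegment_aux {k : ℕ} (p : List Node) (hp : p.IsChain (Arc k)) (b : ℕ)
    (hlast : p.getLast? = some (hub true b)) :
    (∀ a, p.head? = some (hub false a) → ∃ (L : List (ℕ × ℕ)) (hL : L ≠ []),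
      (L.map cell).Sublist p ∧ IsSegment k L hL ∧ IsEntry k false (L.head hL)) ∧
    (∀ u, p.head? = some (cell u) → ∃ (L : List (ℕ × ℕ)) (hL : L ≠ []),
      (L.map cell).Sublist p ∧ IsSegment k L hL ∧
        (L.head hL = u ∨ IsEntry k false (L.head hL))) := by
  induction p with
  | nil => simp
  | cons w p ih =>
    cases p with
    | nil =>
      simp only [List.getLast?_singleton, Option.some.injEq] at hlast
      subst hlast
      simp
    | cons v p =>
      rw [List.isChain_cons_cons] at hp
      rw [List.getLast?_cons_cons] at hlast
      obtain ⟨ih1, ih2⟩ := ih hp.2 hlast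
      have hadj := hp.1
      constructor
      · intro a ha
        simp only [List.head?_cons, Option.some.injEq] at ha
        subst ha
        cases v with
        | hub τ c => exact hadj.elim
        | cell v =>
          obtain ⟨L, hL, h1, h2, h3⟩ := ih2 v rfl
          exact ⟨L, hL, h1.cons _, h2, h3.elim (fun e => e ▸ hadj) id⟩
      · intro u hu
        simp only [List.head?_cons, Option.some.injEq] at hu
        subst hu
        by_cases hex : IsExit k true u
        · exact ⟨[u], List.cons_ne_nil _ _, by simp, ⟨by simp, hex⟩, Or.inl rfl⟩
        · cases v with
          | hub τ c =>
            cases τ with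
            | true => exact absurd hadj hex
            | false =>
              obtain ⟨L, hL, h1, h2, h3⟩ := ih1 c rfl
              exact ⟨L, hL, h1.cons _, h2, Or.inr h3⟩
          | cell v =>
            obtain ⟨L, hL, h1, h2, h3⟩ := ih2 v rfl
            rcases h3 with h3 | h3
            · refine ⟨u :: L, List.cons_ne_nil _ _, h1.cons_cons _, ⟨?_, ?_⟩, Or.inl rfl⟩
              · cases L with
                | nil => exact absurd rfl hL
                | cons v' L =>
                  obtain rfl : v' = v := h3
                  exact List.isChain_cons_cons.2 ⟨⟨hadj, hex⟩, h2.isChain⟩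
              · rw [List.getLast_cons hL]
                exact h2.last
            · exact ⟨L, hL, h1.cons _, h2, Or.inr h3⟩

theorem isInner_false_iff {k c : ℕ} : IsInner k false c ↔ k < c ∧ c ≤ 2 * k := Iff.rfl

theorem isInner_true_iff {k c : ℕ} : IsInner k true c ↔ 2 * k < c ∧ c ≤ 3 * k := Iff.rfl

/-- A segment avoids the arcs from inner tops to leaves. -/
theorem IsSegment.isChain_stripAdj {k : ℕ} {L : List (ℕ × ℕ)} {hL : L ≠ []}
    (h : IsSegment k L hL) (hhead : IsEntry k false (L.head hL)) (hcell : ∀ u ∈ L, IsCell k u)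
    (hnd : L.Nodup) : L.IsChain (StripAdj (stripRel k)) := by
  have hsplit : L.IsChain fun u v => (StripAdj (stripRel k) u v ∧ ¬ IsExit k true u) ∨
      ((IsInnerTop k false u ∧ v.1 = 0) ∧ ¬ IsExit k true u) := by
    refine h.isChain.imp ?_
    rintro u v ⟨h1 | ⟨σ, h1, h2⟩, h3⟩
    · exact Or.inl ⟨h1, h3⟩
    · cases σ with
      | false => exact Or.inr ⟨⟨h1, h2⟩, h3⟩
      | true => exact absurd (Or.inr h1) h3
  rcases isChain_or_split hsplit with h' | ⟨P, M, hP, hM, rfl, hc, ⟨⟨hJ, hJ0⟩, hJe⟩⟩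
  · exact h'.imp fun u v huv => huv.1
  exfalso
  rw [List.head_append_of_ne_nil hP] at hhead
  have hlast := h.last
  rw [List.getLast_append_of_ne_nil _ hM] at hlast
  have hPe := mem_of_isChain_and hc hP hJe
  have hPM : ∀ z ∈ M, z ∉ P := fun z hz hz' => (List.nodup_append.1 hnd).2.2 z hz' z hz rfl
  have hbar : IsBarrier k P hP :=
    ⟨fun u hu => hcell u (List.mem_append_left _ hu), hc.imp fun u v huv => huv.1, hhead.2,
      Or.inl hJ.2⟩
  have hcol := isInner_false_iff.1 hhead.1
  have hcol' := isInner_false_iff.1 hJ.1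
  have hzero : ∀ z : ℕ × ℕ, z.1 = 0 → sideOf P hP z = 0 := fun z hz => by
    rw [sideOf, parityBelow_of_bottom (Or.inl hz), if_neg (by omega), add_zero]
  have hfinal : sideOf P hP (M.getLast hM) = 0 := by
    refine getLast_of_isChain (p := fun z => sideOf P hP z = 0) ?_ hM (hzero _ hJ0)
    refine (isChain_and_of_forall (p := fun z => z ∉ P ∧ IsCell k z)
      (hsplit.right_of_append) fun z hz =>
        ⟨hPM z hz, hcell z (List.mem_append_right _ hz)⟩).imp ?_
    rintro u v ⟨huv, ⟨hu, hu'⟩, hv, hv'⟩ h0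
    rcases huv with huv | huv
    · rw [← hbar.sideOf_eq hu' hv' hu hv huv.1, h0]
    · exact hzero v huv.1.2
  have hmem := List.getLast_mem hM
  have hone : sideOf P hP (M.getLast hM) = 1 := by
    rcases hlast with hlast | hlast
    · rw [sideOf, parityBelow_eq_zero, zero_add, if_pos]
      · rw [hlast, leafCol]; omega
      · rw [hlast]
        exact fun u hu hu' => hPe u hu (Or.inl hu')
    · have := isInner_true_iff.1 hlast.1
      rw [hbar.sideOf_top (hPM _ hmem) hlast.2, if_pos (by omega)]
  exact zero_ne_one (hfinal.symm.trans hone)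

/-- A path between hubs of different sides crosses the strip. -/
theorem exists_crossing {k : ℕ} {p : List Node} (hp : p.IsChain (Arc k)) (hnd : p.Nodup)
    (hv : ∀ u ∈ p, u.Valid k) {a b : ℕ} (hhead : p.head? = some (hub false a))
    (hlast : p.getLast? = some (hub true b)) :
    ∃ (L : List (ℕ × ℕ)) (hL : L ≠ []), (∀ u ∈ L, cell u ∈ p) ∧ (∀ u ∈ L, IsCell k u) ∧
      L.IsChain (StripAdj (stripRel k)) ∧ IsEntry k false (L.head hL) ∧
      IsExit k true (L.getLast hL) := by
  obtain ⟨L, hL, hs, hseg, hent⟩ := (exists_isSegment_aux p hp b hlast).1 a hhead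
  have hsub : ∀ u ∈ L, cell u ∈ p := fun u hu => hs.subset (List.mem_map_of_mem hu)
  have hc : ∀ u ∈ L, IsCell k u := fun u hu => hv _ (hsub u hu)
  exact ⟨L, hL, hsub, hc, hseg.isChain_stripAdj hent hc (hs.nodup hnd).of_map, hent, hseg.last⟩

/-- Two paths that join hubs of different sides in opposite directions meet. -/
theorem exists_common_node {k : ℕ} {p q : List Node} (hp : p.IsChain (Arc k))
    (hq : q.IsChain (Arc k)) (hpn : p.Nodup) (hqn : q.Nodup) (hpv : ∀ u ∈ p, u.Valid k) (hqv : ∀ u ∈ q, u.Valid k)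
    {a b c d : ℕ} (hp1 : p.head? = some (hub false a)) (hp2 : p.getLast? = some (hub true b))
    (hq1 : q.head? = some (hub true c)) (hq2 : q.getLast? = some (hub false d)) :
    ∃ u ∈ p, u ∈ q := by
  by_contra hdisj
  push Not at hdisj
  obtain ⟨P, hP, hPp, hPc, hPchain, hPh, hPl⟩ := exists_crossing hp hpn hpv hp1 hp2
  have hinj : ∀ u ∈ q, ∀ v ∈ q, u.mirror k = v.mirror k → u = v := by
    intro u hu v hv h
    have h1 := hqv u hu
    have h2 := hqv v hv
    cases u <;> cases v <;> simp only [mirror, hub.injEq, cell.injEq, Prod.mk.injEq, reduceCtorEq,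
      Bool.not_inj_iff] at h ⊢
    · exact h
    · exact Prod.ext (by have := h1.1; have := h2.1; omega) h.2
  obtain ⟨Q, hQ, hQq, hQc, hQchain, hQh, hQl⟩ := exists_crossing (k := k) (p := q.map (mirror k))
    (a := c) (b := d)
    (by
      rw [List.isChain_map]
      exact (isChain_and_of_forall hq hqv).imp fun u v h => arc_mirror h.2.1 h.2.2 h.1)
    (hqn.map_on hinj)
    (by
      intro u hu
      obtain ⟨v, hv, rfl⟩ := List.mem_map.1 hu
      exact valid_mirror (hqv v hv))
    (by rw [List.head?_map, hq1]; rfl) (by rw [List.getLast?_map, hq2]; rfl)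
  have hbar : IsBarrier k P hP := ⟨hPc, hPchain, hPh.2, (hPl.imp id And.right).symm⟩
  let m : ℕ × ℕ → ℕ × ℕ := fun u => (4 * k + 1 - u.1, u.2)
  have hmc : ∀ u, IsCell k u → IsCell k (m u) := fun u hu => valid_mirror (u := cell u) hu
  have hQP : ∀ u ∈ Q, m u ∉ P := by
    intro u hu hmu
    obtain ⟨v, hv, e⟩ := List.mem_map.1 (hQq u hu)
    cases v with
    | hub => simp [mirror] at e
    | cell v =>
      simp only [mirror, cell.injEq] at e
      refine hdisj _ (hPp _ hmu) ?_
      have hv1 : v.1 ≤ 4 * k + 1 := (hqv _ hv).1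
      have : m u = v := by
        rw [← e]
        exact Prod.ext (by dsimp only [m]; omega) rfl
      rwa [this]
  have hmem := List.head_mem hQ
  have hmem' := List.getLast_mem hQ
  have h1 : sideOf P hP (m (Q.head hQ)) = 1 := by
    have h1 := isInner_false_iff.1 hQh.1
    have h2 := isInner_false_iff.1 hPh.1
    rw [sideOf, parityBelow_of_bottom (z := m (Q.head hQ)) (Or.inr hQh.2),
      if_pos (by dsimp only [m]; omega), zero_add]
  have h2 : sideOf P hP (m (Q.getLast hQ)) = 1 := by
    refine getLast_of_isChain (p := fun z => sideOf P hP (m z) = 1) ?_ hQ h1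
    refine (isChain_and_of_forall (p := fun z => m z ∉ P ∧ IsCell k z)
      hQchain fun z hz => ⟨hQP z hz, hQc z hz⟩).imp ?_
    rintro u v ⟨huv, ⟨hu, hu'⟩, hv, hv'⟩ h0
    rw [← hbar.sideOf_eq (hmc _ hu') (hmc _ hv') hu hv (stripAdj_mirror hu' hv' huv), h0]
  have h3 : sideOf P hP (m (Q.getLast hQ)) = 0 := by
    rcases hQl with hQl | hQl
    · have : (m (Q.getLast hQ)).1 = 0 := leafCol_mirror hQl
      rw [sideOf, parityBelow_of_bottom (Or.inl this), if_neg (by omega), add_zero]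
    · have h4 := isInnerTop_mirror (hQc _ hmem') hQl
      have h5 := isInner_false_iff.1 h4.1
      rw [hbar.sideOf_top (hQP _ hmem') h4.2, if_neg]
      rcases hPl with hPl | hPl
      · rw [hPl, leafCol]
        dsimp only [m] at h5 ⊢
        omega
      · have h6 := isInner_true_iff.1 hPl.1
        dsimp only [m] at h5 ⊢
        omega
  exact zero_ne_one (h3.symm.trans h2)

/-- The column of depth `δ` on side `σ`. -/
def col (k : ℕ) : Bool → ℕ → ℕ
  | false, δ => 2 * k - δ
  | true, δ => 2 * k + 1 + δ

theorem depth_col {k δ : ℕ} (hδ : δ ≤ 2 * k) (σ : Bool) : depth k (col k σ δ) = δ := by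
  cases σ
  · rw [depth, col, if_pos (by omega)]
    omega
  · rw [depth, col, if_neg (by omega)]
    omega

theorem isCell_col {k δ q : ℕ} {σ : Bool} (hδ : δ ≤ 2 * k) :
    IsCell k (col k σ δ, q) ↔ q < (k + 1) ^ (δ + 1) := by
  have h1 : width k (col k σ δ) = (k + 1) ^ (depth k (col k σ δ) + 1) := rfl
  rw [depth_col hδ] at h1
  rw [IsCell, h1]
  refine and_iff_right ?_
  cases σ <;> simp only [col] <;> omega

theorem exists_eq_col {k : ℕ} {u : ℕ × ℕ} (hu : IsCell k u) :
    ∃ σ, ∃ δ ≤ 2 * k, u = (col k σ δ, u.2) := by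
  have h := hu.1
  by_cases h' : u.1 ≤ 2 * k
  · exact ⟨false, 2 * k - u.1, by omega, Prod.ext (by simp only [col]; omega) rfl⟩
  · exact ⟨true, u.1 - (2 * k + 1), by omega, Prod.ext (by simp only [col]; omega) rfl⟩

theorem isInner_col {k δ : ℕ} (hδ : δ < k) (σ : Bool) : IsInner k σ (col k σ δ) := by
  cases σ <;> simp only [IsInner, col] <;> omega

theorem col_leaf (k : ℕ) (σ : Bool) : col k σ (2 * k) = leafCol k σ := by
  cases σ <;> simp only [leafCol, col] <;> omega

theorem stripAdj_child {k δ : ℕ} (hδ : δ < 2 * k) (σ : Bool) {q q' : ℕ} (h : q' / (k + 1) = q) :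
    StripAdj (stripRel k) (col k σ δ, q) (col k σ (δ + 1), q') := by
  cases σ
  · refine Or.inr (Or.inr ⟨by simp only [col]; omega, Or.inl ⟨?_, h.symm⟩⟩)
    simp only [col]; omega
  · refine Or.inr (Or.inl ⟨by simp only [col]; omega, Or.inr (Or.inr ⟨?_, h.symm⟩)⟩)
    simp only [col]; omega

theorem exists_lt_forall_ne {S : Finset Node} {n : ℕ} (h : S.card < n) (f : Node → ℕ) :
    ∃ j < n, ∀ s ∈ S, f s ≠ j := by
  obtain ⟨j, hj, hj'⟩ := Finset.exists_mem_notMem_of_card_lt_card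
    (s := S.image f) (t := Finset.range n) (by
      rw [Finset.card_range]
      exact Finset.card_image_le.trans_lt h)
  exact ⟨j, Finset.mem_range.1 hj, fun s hs e => hj' (Finset.mem_image.2 ⟨s, hs, e⟩)⟩

/-- Extend a function on cells by zero to the hubs. -/
def cellFun (f : ℕ → ℕ → ℕ) : Node → ℕ
  | hub _ _ => 0
  | cell u => f u.1 u.2

/-- A cell outside `S`. -/
def IsLive (k : ℕ) (S : Finset Node) (u : ℕ × ℕ) : Prop := IsCell k u ∧ cell u ∉ S

/-- A planar step outside `S`. -/
def PlanarStep (k : ℕ) (S : Finset Node) (u v : ℕ × ℕ) : Prop :=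
  IsLive k S u ∧ IsLive k S v ∧ StripAdj (stripRel k) u v

/-- Being joined by planar steps outside `S`. -/
def PlanarJoined (k : ℕ) (S : Finset Node) : ℕ × ℕ → ℕ × ℕ → Prop :=
  Relation.ReflTransGen (PlanarStep k S)

theorem PlanarJoined.symm {k : ℕ} {S : Finset Node} {u v : ℕ × ℕ} (h : PlanarJoined k S u v) :
    PlanarJoined k S v u := by
  induction h with
  | refl => exact Relation.ReflTransGen.refl
  | tail _ h ih => exact ih.head ⟨h.2.1, h.1, h.2.2.symm⟩

/-- The leftmost descendants of a cell are joined to it, if all of them survive. -/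
theorem joined_descend {k : ℕ} {S : Finset Node} {σ : Bool} {δ q : ℕ} (t : ℕ)
    (ht : δ + t ≤ 2 * k) (h : ∀ s ≤ t, IsLive k S (col k σ (δ + s), q * (k + 1) ^ s)) :
    PlanarJoined k S (col k σ δ, q) (col k σ (δ + t), q * (k + 1) ^ t) := by
  induction t with
  | zero =>
    rw [pow_zero, mul_one, add_zero]
    exact Relation.ReflTransGen.refl
  | succ t ih =>
    refine (ih (by omega) fun s hs => h s (by omega)).tail ⟨h t (by omega), h (t + 1) le_rfl, ?_⟩
    refine stripAdj_child (by omega) σ ?_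
    rw [pow_succ, ← mul_assoc, Nat.mul_div_cancel _ (Nat.succ_pos k)]

/-- Every surviving cell is joined to a surviving cell of each larger depth. -/
theorem exists_joined_depth {k : ℕ} {S : Finset Node} (hS : S.card < k) {σ : Bool} {δ q : ℕ}
    (hq : IsLive k S (col k σ δ, q)) {ε : ℕ} (hδ : δ ≤ ε) (hε : ε ≤ 2 * k) :
    ∃ q', IsLive k S (col k σ ε, q') ∧ PlanarJoined k S (col k σ δ, q) (col k σ ε, q') := by
  rcases hδ.eq_or_lt with rfl | hlt
  · exact ⟨q, hq, Relation.ReflTransGen.refl⟩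
  obtain ⟨c, hc, hcS⟩ := exists_lt_forall_ne (S := S) (n := k + 1) (by omega)
    (cellFun fun i p => p / (k + 1) ^ (depth k i - (δ + 1)) - q * (k + 1))
  have hq1 := (isCell_col (σ := σ) (by omega)).1 hq.1
  have hlive : ∀ s ≤ ε - (δ + 1),
      IsLive k S (col k σ (δ + 1 + s), (q * (k + 1) + c) * (k + 1) ^ s) := by
    intro s hs
    have hpos : 0 < (k + 1) ^ s := by positivity
    refine ⟨(isCell_col (by omega)).2 ?_, fun hmem => hcS _ hmem ?_⟩
    · have h1 : q * (k + 1) + c < (k + 1) ^ (δ + 1) * (k + 1) := by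
        have := Nat.mul_le_mul_right (k + 1) (Nat.succ_le_of_lt hq1)
        rw [Nat.succ_eq_add_one, add_mul] at this
        omega
      calc _ < (k + 1) ^ (δ + 1) * (k + 1) * (k + 1) ^ s := Nat.mul_lt_mul_of_pos_right h1 hpos
        _ = _ := by ring
    · simp only [cellFun]
      rw [depth_col (by omega), Nat.add_sub_cancel_left, Nat.mul_div_cancel _ hpos,
        Nat.add_sub_cancel_left]
  have hj := joined_descend (S := S) (ε - (δ + 1)) (by omega) hlive
  have e : δ + 1 + (ε - (δ + 1)) = ε := by omega
  have hend := hlive _ le_rfl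
  rw [e] at hj hend
  refine ⟨_, hend, Relation.ReflTransGen.head ⟨hq, ?_, ?_⟩ hj⟩
  · simpa using hlive 0 (Nat.zero_le _)
  · refine stripAdj_child (by omega) σ ?_
    rw [mul_comm, Nat.mul_add_div (Nat.succ_pos k), Nat.div_eq_of_lt hc, add_zero]

/-- A whole layer of depth at least `k` survives. -/
theorem exists_live_layer {k : ℕ} {S : Finset Node} (hS : S.card < k) :
    ∃ ε, k ≤ ε ∧ ε ≤ 2 * k ∧ ∀ σ, ∀ q < (k + 1) ^ (ε + 1), IsLive k S (col k σ ε, q) := by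
  obtain ⟨j, hj, hjS⟩ := exists_lt_forall_ne (S := S) (n := k + 1) (by omega)
    (cellFun fun i _ => depth k i - k)
  refine ⟨k + j, by omega, by omega, fun σ q hq => ⟨(isCell_col (by omega)).2 hq, fun hmem =>
    hjS _ hmem ?_⟩⟩
  simp only [cellFun]
  rw [depth_col (by omega), Nat.add_sub_cancel_left]

/-- The leftmost branch below some root survives on both sides. -/
theorem exists_live_branch {k : ℕ} {S : Finset Node} (hS : S.card < k) :
    ∃ j, ∀ σ, ∀ t ≤ 2 * k, IsLive k S (col k σ t, j * (k + 1) ^ t) := by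
  obtain ⟨j, hj, hjS⟩ := exists_lt_forall_ne (S := S) (n := k + 1) (by omega)
    (cellFun fun i p => p / (k + 1) ^ depth k i)
  refine ⟨j, fun σ t ht => ⟨(isCell_col ht).2 ?_, fun hmem => hjS _ hmem ?_⟩⟩
  · rw [pow_succ, mul_comm]
    exact Nat.mul_lt_mul_of_pos_left hj (by positivity)
  · simp only [cellFun]
    rw [depth_col ht, Nat.mul_div_cancel _ (by positivity)]

theorem exists_core {k : ℕ} {S : Finset Node} (hS : S.card < k) :
    ∃ r, (∀ σ δ q, δ ≤ k → IsLive k S (col k σ δ, q) → PlanarJoined k S (col k σ δ, q) r) ∧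
      ∀ σ, ∃ q, IsLive k S (col k σ (2 * k), q) ∧ PlanarJoined k S (col k σ (2 * k), q) r := by
  obtain ⟨ε, hε, hε', hlayer⟩ := exists_live_layer hS
  obtain ⟨j, hj⟩ := exists_live_branch hS
  have hroot : ∀ σ, PlanarJoined k S (col k σ 0, j) (col k false 0, j) := by
    intro σ
    cases σ with
    | false => exact Relation.ReflTransGen.refl
    | true =>
      refine (Relation.ReflTransGen.single ⟨?_, ?_, ?_⟩ : PlanarJoined k S _ _)
      · simpa using hj true 0 (Nat.zero_le _)
      · simpa using hj false 0 (Nat.zero_le _)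
      · exact Or.inr (Or.inr ⟨rfl, Or.inr (Or.inl ⟨rfl, rfl⟩)⟩)
  have hbranch : ∀ σ, ∀ t ≤ 2 * k,
      PlanarJoined k S (col k σ t, j * (k + 1) ^ t) (col k false 0, j) := by
    intro σ t ht
    have := joined_descend (k := k) (S := S) (σ := σ) (δ := 0) (q := j) t (by omega) fun s hs => by
      rw [zero_add]
      exact hj σ s (hs.trans ht)
    rw [zero_add] at this
    exact this.symm.trans (hroot σ)
  have hbot : ∀ σ, ∀ q < (k + 1) ^ (ε + 1), PlanarJoined k S (col k σ ε, q) (col k σ ε, 0) := by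
    intro σ q
    induction q with
    | zero => exact fun _ => Relation.ReflTransGen.refl
    | succ q ih =>
      intro hq
      exact (ih (by omega)).head ⟨hlayer σ _ hq, hlayer σ q (by omega), Or.inl ⟨rfl, Or.inr rfl⟩⟩
  refine ⟨(col k false 0, j), fun σ δ q hδ hq => ?_, fun σ => ⟨_, hj σ _ le_rfl, hbranch σ _ le_rfl⟩⟩
  obtain ⟨q', hq', hqq'⟩ := exists_joined_depth hS hq (hδ.trans hε) hε'
  exact hqq'.trans ((hbot σ q' ((isCell_col hε').1 hq'.1)).trans
    ((hbot σ _ ((isCell_col hε').1 (hj σ ε hε').1)).symm.trans (hbranch σ ε hε')))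

/-- An arc outside `S`. -/
def Step (k : ℕ) (S : Finset Node) (u v : Node) : Prop :=
  Arc k u v ∧ (u.Valid k ∧ u ∉ S) ∧ v.Valid k ∧ v ∉ S

theorem PlanarJoined.reflTransGen {k : ℕ} {S : Finset Node} {u v : ℕ × ℕ}
    (h : PlanarJoined k S u v) :
    Relation.ReflTransGen (Step k S) (cell u) (cell v) :=
  h.lift cell fun _ _ h => ⟨Or.inl h.2.2, h.1, h.2.1⟩

/-- Some inner layer has no vertex in `S`. -/
theorem exists_live_inner {k : ℕ} {S : Finset Node} (hS : S.card < k) :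
    ∃ δ < k, ∀ σ, ∀ q < (k + 1) ^ (δ + 1), IsLive k S (col k σ δ, q) := by
  obtain ⟨δ, hδ, hδS⟩ := exists_lt_forall_ne hS (cellFun fun i _ => depth k i)
  exact ⟨δ, hδ, fun σ q hq => ⟨(isCell_col (by omega)).2 hq, fun hmem =>
    hδS _ hmem (depth_col (by omega) σ)⟩⟩

theorem exists_live_hub {k : ℕ} {S : Finset Node} (hS : S.card < k) (σ : Bool) :
    ∃ a ≤ k, hub σ a ∉ S := by
  obtain ⟨a, ha, haS⟩ := exists_lt_forall_ne (S := S) (n := k + 1) (by omega) fun u =>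
    match u with
    | hub _ a => a
    | cell _ => 0
  exact ⟨a, by omega, fun hmem => haS _ hmem rfl⟩

theorem reflTransGen_step {k : ℕ} {S : Finset Node} (hS : S.card < k) {u v : Node}
    (hu : u.Valid k ∧ u ∉ S) (hv : v.Valid k ∧ v ∉ S) :
    Relation.ReflTransGen (Step k S) u v := by
  obtain ⟨r, hr, hleaf⟩ := exists_core hS
  obtain ⟨δ, hδ, hlayer⟩ := exists_live_inner hS
  have hhub : ∀ σ a, (hub σ a).Valid k ∧ hub σ a ∉ S →
      Relation.ReflTransGen (Step k S) (hub σ a) (cell r) := fun σ a ha =>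
    have h0 := hlayer σ 0 (by positivity)
    have harc : Step k S (hub σ a) (cell (col k σ δ, 0)) := ⟨⟨isInner_col hδ σ, rfl⟩, ha, h0⟩
    (hr σ δ 0 hδ.le h0).reflTransGen.head harc
  have hout : ∀ u, u.Valid k ∧ u ∉ S → Relation.ReflTransGen (Step k S) u (cell r) := by
    rintro (⟨σ, a⟩ | u) hu
    · exact hhub σ a hu
    · obtain ⟨σ, ε, hε, e⟩ := exists_eq_col hu.1
      rw [e] at hu ⊢
      obtain ⟨q', hq', hj⟩ := exists_joined_depth hS hu hε le_rfl
      obtain ⟨a, ha⟩ := exists_live_hub hS σ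
      have harc : Step k S (cell (col k σ (2 * k), q')) (hub σ a) :=
        ⟨Or.inl (col_leaf k σ), hq', ha⟩
      exact hj.reflTransGen.trans ((hhub σ a ha).head harc)
  have hin : ∀ u, u.Valid k ∧ u ∉ S → Relation.ReflTransGen (Step k S) (cell r) u := by
    rintro (⟨σ, a⟩ | u) hu
    · obtain ⟨q, hq, hj⟩ := hleaf σ
      exact hj.symm.reflTransGen.tail ⟨Or.inl (col_leaf k σ), hq, hu⟩
    · obtain ⟨σ, ε, hε, e⟩ := exists_eq_col hu.1
      rw [e] at hu ⊢
      obtain ⟨q', hq', hj⟩ := exists_joined_depth hS hu hε le_rfl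
      have hpos : 0 < (k + 1) ^ (δ + 1) := by positivity
      have htop := hlayer σ ((k + 1) ^ (δ + 1) - 1) (by omega)
      have hwidth : width k (col k σ δ) = (k + 1) ^ (depth k (col k σ δ) + 1) := rfl
      rw [depth_col (by omega)] at hwidth
      have harc : Step k S (cell (col k σ δ, (k + 1) ^ (δ + 1) - 1))
          (cell (col k σ (2 * k), q')) :=
        ⟨Or.inr ⟨σ, ⟨isInner_col hδ σ, by dsimp only; omega⟩, col_leaf k σ⟩, htop, hq'⟩
      exact ((hr σ δ _ hδ.le htop).symm.reflTransGen.tail harc).trans hj.symm.reflTransGen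
  exact (hout u hu).trans (hin v hv)

theorem Node.finite_valid (k : ℕ) : Finite {u : Node // u.Valid k} := by
  have h : ((fun x : Bool × ℕ => hub x.1 x.2) '' (Set.univ ×ˢ Set.Iic k) ∪
      cell '' ⋃ c ∈ Set.Iic (4 * k + 1), Prod.mk c '' Set.Iio (width k c)).Finite :=
    ((Set.finite_univ.prod (Set.finite_Iic k)).image _).union
      (((Set.finite_Iic _).biUnion fun c _ => (Set.finite_Iio _).image _).image _)
  refine (h.subset ?_).to_subtype
  rintro (⟨σ, a⟩ | ⟨c, q⟩) hu
  · exact Or.inl ⟨(σ, a), ⟨trivial, hu⟩, rfl⟩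
  · refine Or.inr ⟨_, ?_, rfl⟩
    simp only [Set.mem_iUnion]
    exact ⟨c, hu.1, q, hu.2, rfl⟩

theorem Node.not_arc_self (k : ℕ) (u : Node) : ¬ Arc k u u := by
  rcases u with ⟨σ, a⟩ | ⟨c, q⟩
  · exact id
  · rintro (h | ⟨σ, h, h'⟩)
    · simp only [StripAdj] at h
      omega
    · have := h.1
      rw [show (c, q).1 = c from rfl] at this h'
      cases σ <;> simp only [IsInner, leafCol] at this h' <;> omega

theorem exists_nodup_chain {α : Type} {r : α → α → Prop} {P : α → Prop} {x y : α}
    (hr : ∀ a b, r a b → P a) (hy : P y) (h : Relation.ReflTransGen r x y) :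
    ∃ p : List α, p.head? = some x ∧ p.getLast? = some y ∧ p.IsChain r ∧ p.Nodup ∧
      ∀ v ∈ p, P v := by
  induction h using Relation.ReflTransGen.head_induction_on with
  | refl => exact ⟨[y], by simpa using hy⟩
  | @head a b hab _ ih =>
    obtain ⟨p, h1, h2, h3, h4, h5⟩ := ih
    by_cases ha : a ∈ p
    · obtain ⟨s, t, rfl⟩ := List.append_of_mem ha
      refine ⟨a :: t, rfl, ?_, h3.right_of_append, h4.of_append_right, fun v hv =>
        h5 v (List.mem_append_right _ hv)⟩
      rwa [List.getLast?_append_of_ne_nil _ (List.cons_ne_nil a t)] at h2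
    · cases p with
      | nil => simp at h1
      | cons c p =>
        simp only [List.head?_cons, Option.some.injEq] at h1
        subst h1
        refine ⟨a :: c :: p, rfl, by rwa [List.getLast?_cons_cons],
          List.isChain_cons_cons.2 ⟨hab, h3⟩, List.nodup_cons.2 ⟨ha, h4⟩, ?_⟩
        simpa using ⟨hr a c hab, by simpa using h5⟩

/-- The digraph on `Fin n` given by an enumeration of the nodes. -/
def nodeDigraph {k n : ℕ} (e : Fin n ≃ {u : Node // u.Valid k}) : Digr (Fin n) where
  Adj a b := Arc k (e a) (e b)
  irrefl a := Node.not_arc_self k (e a)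

theorem kStrong_nodeDigraph {k n : ℕ} (hk : 1 ≤ k) (e : Fin n ≃ {u : Node // u.Valid k}) :
    (nodeDigraph e).KStrong k := by
  refine ⟨?_, fun S hS x hx y hy _ => ?_⟩
  · let f : Fin (k + 1) → Fin n := fun a => e.symm ⟨hub false a, Nat.le_of_lt_succ a.2⟩
    have hf : Function.Injective f := fun a b h => by
      simpa [Fin.ext_iff] using congrArg Subtype.val (e.symm.injective h)
    simpa using Fintype.card_le_of_injective f hf
  · classical
    let T : Finset Node := S.image fun a => (e a : Node)
    have hT : T.card < k := Finset.card_image_le.trans_lt (by omega)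
    have hmem : ∀ a, (e a : Node) ∉ T ↔ a ∉ S := by
      intro a
      simp [T, Subtype.ext_iff.symm]
    have hreach : ∀ v, Relation.ReflTransGen (Step k T) (e x) v → ∀ b, (e b : Node) = v →
        Relation.ReflTransGen (fun a b => (nodeDigraph e).Adj a b ∧ a ∉ S) x b := by
      intro v h
      induction h with
      | refl =>
        intro b hb
        rw [e.injective (Subtype.ext hb)]
      | @tail u v _ huv ih =>
        rintro b rfl
        have hu : (e (e.symm ⟨u, huv.2.1.1⟩) : Node) = u := by simp
        refine (ih _ hu).tail ⟨?_, ?_⟩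
        · change Arc k _ _
          rw [hu]
          exact huv.1
        · rw [← hmem, hu]
          exact huv.2.1.2
    have hx' : x ∉ S := by simpa using hx
    have hy' : y ∉ S := by simpa using hy
    obtain ⟨p, h1, h2, h3, h4, h5⟩ := exists_nodup_chain (P := fun a => a ∉ S)
      (fun a b h => h.2) hy' (hreach _ (reflTransGen_step hT ⟨(e x).2, (hmem x).2 hx'⟩
        ⟨(e y).2, (hmem y).2 hy'⟩) y rfl)
    exact ⟨p, ⟨h1, h2, h3.imp fun _ _ h => h.1, h4⟩, fun v hv => by simpa using h5 v hv⟩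

theorem not_kLinked_nodeDigraph {k n : ℕ} (hk : 1 ≤ k) (e : Fin n ≃ {u : Node // u.Valid k}) :
    ¬ (nodeDigraph e).KLinked 2 := by
  rintro ⟨-, h⟩
  let v : Bool → Fin 2 → Fin n := fun σ a =>
    e.symm ⟨hub σ a, show (a : ℕ) ≤ k from (Nat.le_of_lt_succ a.2).trans hk⟩
  have hv : ∀ σ a, (e (v σ a) : Node) = hub σ a := fun σ a => by simp [v]
  have hinj : ∀ σ τ a b, v σ a = v τ b → σ = τ ∧ a = b := fun σ τ a b hab => by
    have := congrArg (fun w => (e w : Node)) hab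
    simpa [hv, Fin.ext_iff] using this
  obtain ⟨P, hP, hdisj⟩ := h ![v false 0, v true 1] ![v true 0, v false 1] (by
    rintro (i | i) (j | j) hij <;> fin_cases i <;> fin_cases j <;>
      first
        | rfl
        | exact absurd (hinj _ _ _ _ hij) (by decide))
  let f : Fin n → Node := fun a => e a
  have hf : Function.Injective f := Subtype.val_injective.comp e.injective
  have hvalid : ∀ p : List (Fin n), ∀ u ∈ p.map f, u.Valid k := by
    intro p u hu
    obtain ⟨a, -, rfl⟩ := List.mem_map.1 hu
    exact (e a).2
  have hchain : ∀ i, ((P i).map f).IsChain (Arc k) := fun i =>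
    (List.isChain_map f).2 (hP i).2.2.1
  have hnd : ∀ i, ((P i).map f).Nodup := fun i => (hP i).2.2.2.map hf
  obtain ⟨u, hu, hu'⟩ := exists_common_node (hchain 0) (hchain 1) (hnd 0) (hnd 1) (hvalid _)
    (hvalid _) (a := 0) (b := 0) (c := 1) (d := 1)
    (by rw [List.head?_map, (hP 0).1]; exact congrArg some (hv false 0))
    (by rw [List.getLast?_map, (hP 0).2.1]; exact congrArg some (hv true 0))
    (by rw [List.head?_map, (hP 1).1]; exact congrArg some (hv true 1))
    (by rw [List.getLast?_map, (hP 1).2.1]; exact congrArg some (hv false 1))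
  obtain ⟨a, ha, rfl⟩ := List.mem_map.1 hu
  obtain ⟨b, hb, hab⟩ := List.mem_map.1 hu'
  rw [hf hab] at hb
  exact hdisj 0 1 (by decide) a ha hb

/-- Thomassen: For each positive integer l, there exists an
l-strong digraph that is not 2-linked. -/
theorem exists_l_strong_not_2_linked (l : ℕ) (hl : 1 ≤ l) :
    ∃ (n : ℕ) (G : Digr (Fin n)), G.KStrong l ∧ ¬ G.KLinked 2 := by
  have := Node.finite_valid l
  let e := (Finite.equivFin {u : Node // u.Valid l}).symm
  exact ⟨_, nodeDigraph e, kStrong_nodeDigraph hl e, not_kLinked_nodeDigraph hl e⟩
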